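/- Let k ≥ 3 be an integer and let T be a fixed tree on k vertices. If t = t(n) and b = b(n) satisfy b·(t/n)^{k−2} → 0 as n → ∞ (i.e. b ≪ (n/t)^{k−2}), then for every (t,b)-strategy B of Builder, the probability that the purchased graph B_t contains a subgraph isomorphic to T tends to 0 as n → ∞. -/

import Mathlib

open Filter

attribute [local instance] Classical.propDecidable

/-- The edges of the complete graph on `Fin n`: non-diagonal unordered pairs. -/
abbrev CEdge (n : ℕ) : Type := {e : Sym2 (Fin n) // ¬ e.IsDiag}

/-- The sample space: a uniformly random ordering of the edges of `K_n`,
encoded as a bijection from positions to edges. -/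
abbrev EdgeOrdering (n : ℕ) : Type := Fin (Fintype.card (CEdge n)) ≃ CEdge n

/-- The uniform probability of an event on a finite sample space. -/
noncomputable def uprob {α : Type} [Fintype α] (P : α → Prop) : ℝ :=
  ((Finset.univ.filter P).card : ℝ) / (Fintype.card α : ℝ)

/-- A (deterministic) strategy of Builder: given the current time `s`, the graph `B_{s-1}`
of previously purchased edges, and the observed edge `e_s`, decide whether to purchase it. -/
def Strategy (n : ℕ) : Type := ℕ → Finset (CEdge n) → CEdge n → Bool

/-- Builder's purchased graph `B_s` at time `s`, playing strategy `S` with budget `b`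
on the ordering `ω`.  An edge is purchased iff the strategy accepts it and the budget permits. -/
noncomputable def build (n b : ℕ) (S : Strategy n) (ω : EdgeOrdering n) : ℕ → Finset (CEdge n)
  | 0 => ∅
  | s + 1 =>
    let P := build n b S ω s
    if h : s < Fintype.card (CEdge n) then
      if S s P (ω ⟨s, h⟩) = true ∧ P.card < b then insert (ω ⟨s, h⟩) P else P
    else P

/-- The degree of the vertex `v` in the graph given by the edge set `P`. -/
noncomputable def edegree (n : ℕ) (P : Finset (CEdge n)) (v : Fin n) : ℕ :=
  (P.filter (fun e => v ∈ (e : Sym2 (Fin n)))).card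


/-- The edge set `P` contains a copy of the graph `T` (as a subgraph). -/
def containsCopy {k : ℕ} (T : SimpleGraph (Fin k)) (n : ℕ) (P : Finset (CEdge n)) : Prop :=
  ∃ f : Fin k → Fin n, Function.Injective f ∧
    ∀ u v : Fin k, T.Adj u v → ∃ e ∈ P, (e : Sym2 (Fin n)) = s(f u, f v)

/-- The event that the edge at position `s` is purchased. -/
def Purchased (n b : ℕ) (S : Strategy n) (s : Fin (Fintype.card (CEdge n)))
    (ω : EdgeOrdering n) : Prop :=
  S s (build n b S ω s) (ω s) = true ∧ (build n b S ω s).card < b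

lemma build_succ (n b : ℕ) (S : Strategy n) (ω : EdgeOrdering n) (s : ℕ)
    (h : s < Fintype.card (CEdge n)) :
    build n b S ω (s + 1) =
      if Purchased n b S ⟨s, h⟩ ω then insert (ω ⟨s, h⟩) (build n b S ω s)
      else build n b S ω s := by
  rw [build]
  refine (dif_pos h).trans ?_
  unfold Purchased
  congr

lemma build_succ_of_le (n b : ℕ) (S : Strategy n) (ω : EdgeOrdering n) (s : ℕ)
    (h : Fintype.card (CEdge n) ≤ s) : build n b S ω (s + 1) = build n b S ω s := by
  rw [build]
  exact dif_neg (not_lt.2 h)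

lemma mem_build (n b : ℕ) (S : Strategy n) (ω : EdgeOrdering n) (s : ℕ) (e : CEdge n) :
    e ∈ build n b S ω s ↔ ((ω.symm e : ℕ) < s ∧ Purchased n b S (ω.symm e) ω) := by
  induction s with
  | zero => simp [build]
  | succ s ih =>
    by_cases h : s < Fintype.card (CEdge n)
    · rw [build_succ n b S ω s h]
      by_cases he : (ω.symm e : ℕ) = s
      · have h1 : ω.symm e = ⟨s, h⟩ := Fin.ext he
        have h2 : e = ω ⟨s, h⟩ := by rw [← h1]; simp
        split_ifs with hp
        · simp [← h2, h1, hp]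
        · simp [ih, h1, hp]
      · have h2 : e ≠ ω ⟨s, h⟩ := by
          rintro rfl
          simp at he
        split_ifs with hp
        · rw [Finset.mem_insert, ih]
          simp only [h2, false_or]
          refine and_congr_left fun _ => by omega
        · rw [ih]
          refine and_congr_left fun _ => by omega
    · rw [build_succ_of_le n b S ω s (not_lt.1 h), ih]
      have := (ω.symm e).isLt
      refine and_congr_left fun _ => by omega

lemma card_build_le (n b : ℕ) (S : Strategy n) (ω : EdgeOrdering n) (s : ℕ) :
    (build n b S ω s).card ≤ b := by
  induction s with
  | zero => simp [build]
  | succ s ih =>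
    by_cases h : s < Fintype.card (CEdge n)
    · rw [build_succ n b S ω s h]
      split_ifs with hp
      · exact (Finset.card_insert_le _ _).trans hp.2
      · exact ih
    · rwa [build_succ_of_le n b S ω s (not_lt.1 h)]

lemma card_purchased_le (n b : ℕ) (S : Strategy n) (ω : EdgeOrdering n) :
    (Finset.univ.filter fun s => Purchased n b S s ω).card ≤ b := by
  refine le_trans ?_ (card_build_le n b S ω (Fintype.card (CEdge n)))
  refine Finset.card_le_card_of_injOn ω ?_ ω.injective.injOn
  intro s hs
  have hs' : Purchased n b S s ω := by simpa using hs
  rw [Finset.mem_coe, mem_build, Equiv.symm_apply_apply]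
  exact ⟨s.isLt, hs'⟩

lemma build_congr (n b : ℕ) (S : Strategy n) (ω ω' : EdgeOrdering n) (s : ℕ)
    (h : ∀ i : Fin (Fintype.card (CEdge n)), (i : ℕ) < s → ω i = ω' i) : build n b S ω s = build n b S ω' s := by
  induction s with
  | zero => rfl
  | succ s ih =>
    have ih' := ih fun i hi => h i (by omega)
    by_cases hs : s < Fintype.card (CEdge n)
    · rw [build_succ n b S ω s hs, build_succ n b S ω' s hs]
      simp only [Purchased, ih', h ⟨s, hs⟩ (Nat.lt_succ_self s)]
      congr
    · rw [build_succ_of_le n b S ω s (not_lt.1 hs), build_succ_of_le n b S ω' s (not_lt.1 hs), ih']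

lemma purchased_congr (n b : ℕ) (S : Strategy n) (s : Fin (Fintype.card (CEdge n)))
    (ω ω' : EdgeOrdering n) (h : ∀ i ≤ s, ω i = ω' i) :
    Purchased n b S s ω ↔ Purchased n b S s ω' := by
  have h1 := build_congr n b S ω ω' s fun i hi => h i (le_of_lt hi)
  simp only [Purchased, h1, h s le_rfl]

/-- `Q` only depends on the values of the ordering at the positions in `A`. -/
def DependsOnPositions {α β : Type} (A : Finset α) (Q : α ≃ β → Prop) : Prop :=
  ∀ ω ω' : α ≃ β, (∀ a ∈ A, ω a = ω' a) → (Q ω ↔ Q ω')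

lemma card_filter_eq_mul_le {α β : Type} [Fintype α] [Fintype β] (A : Finset α)
    (Q : α ≃ β → Prop) (hQ : DependsOnPositions A Q) (q : α) (hq : q ∉ A) (g : β) :
    (Finset.univ.filter fun ω : α ≃ β => Q ω ∧ ω q = g).card * (Fintype.card α - A.card) ≤
      (Finset.univ.filter Q).card := by
  have hswap : ∀ q' ∈ Aᶜ,
      (Finset.univ.filter fun ω : α ≃ β => Q ω ∧ ω q = g).card ≤
        (Finset.univ.filter fun ω : α ≃ β => Q ω ∧ ω q' = g).card := by
    intro q' hq'
    rw [Finset.mem_compl] at hq'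
    refine Finset.card_le_card_of_injOn (fun ω => (Equiv.swap q q').trans ω) ?_ ?_
    · intro ω hω
      have hω' : Q ω ∧ ω q = g := by simpa using hω
      have h1 : Q ((Equiv.swap q q').trans ω) := by
        refine (hQ _ _ fun a ha => ?_).1 hω'.1
        rw [Equiv.trans_apply, Equiv.swap_apply_of_ne_of_ne]
        · rintro rfl; exact hq ha
        · rintro rfl; exact hq' ha
      simp [h1, hω'.2]
    · intro ω _ ω' _ h
      ext x
      have := congrArg (fun τ : α ≃ β => τ (Equiv.swap q q' x)) h
      simpa using this
  calc _ = ∑ _q' ∈ Aᶜ, (Finset.univ.filter fun ω : α ≃ β => Q ω ∧ ω q = g).card := by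
        rw [Finset.sum_const, Finset.card_compl, smul_eq_mul, mul_comm]
    _ ≤ ∑ q' ∈ Aᶜ, (Finset.univ.filter fun ω : α ≃ β => Q ω ∧ ω q' = g).card :=
        Finset.sum_le_sum hswap
    _ = (Aᶜ.biUnion fun q' => Finset.univ.filter fun ω : α ≃ β => Q ω ∧ ω q' = g).card := by
        rw [Finset.card_biUnion]
        intro x _ y _ hxy
        rw [Function.onFun, Finset.disjoint_left]
        intro ω h1 h2
        simp only [Finset.mem_filter, Finset.mem_univ, true_and] at h1 h2
        exact hxy (ω.injective (h1.2.trans h2.2.symm))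
    _ ≤ _ := by
        refine Finset.card_le_card fun ω hω => ?_
        simp only [Finset.mem_biUnion, Finset.mem_filter, Finset.mem_univ, true_and] at hω ⊢
        obtain ⟨_, _, h, _⟩ := hω
        exact h

lemma card_filter_forall_mul_pow_le {α β : Type} [Fintype α] [Fintype β] (R : Finset α) (c : ℕ)
    (D : Finset β) : ∀ (A : Finset α) (Q : α ≃ β → Prop), DependsOnPositions A Q →
      c + A.card + D.card ≤ Fintype.card α →
      (Finset.univ.filter fun ω : α ≃ β =>
        Q ω ∧ ∀ g ∈ D, ω.symm g ∈ R ∧ ω.symm g ∉ A).card * c ^ D.card ≤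
        (Finset.univ.filter Q).card * R.card ^ D.card := by
  induction D using Finset.induction_on with
  | empty => intro A Q _ _; simp
  | insert g D hg ih =>
    intro A Q hQ hc
    rw [Finset.card_insert_of_notMem hg] at hc ⊢
    have hsub : (Finset.univ.filter fun ω : α ≃ β =>
        Q ω ∧ ∀ g' ∈ insert g D, ω.symm g' ∈ R ∧ ω.symm g' ∉ A) ⊆
        (R \ A).biUnion fun q => Finset.univ.filter fun ω : α ≃ β =>
          (Q ω ∧ ω q = g) ∧ ∀ g' ∈ D, ω.symm g' ∈ R ∧ ω.symm g' ∉ insert q A := by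
      intro ω hω
      simp only [Finset.mem_biUnion, Finset.mem_filter, Finset.mem_univ, true_and,
        Finset.mem_sdiff] at hω ⊢
      refine ⟨ω.symm g, hω.2 g (Finset.mem_insert_self _ _), ⟨hω.1, by simp⟩, fun g' hg' => ?_⟩
      have h := hω.2 g' (Finset.mem_insert_of_mem hg')
      refine ⟨h.1, fun h' => ?_⟩
      rcases Finset.mem_insert.1 h' with h' | h'
      · exact hg (ω.symm.injective h' ▸ hg')
      · exact h.2 h'
    have hterm : ∀ q ∈ R \ A, (Finset.univ.filter fun ω : α ≃ β =>
          (Q ω ∧ ω q = g) ∧ ∀ g' ∈ D, ω.symm g' ∈ R ∧ ω.symm g' ∉ insert q A).card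
          * c ^ (D.card + 1) ≤ (Finset.univ.filter Q).card * R.card ^ D.card := by
      intro q hq
      have hqA := (Finset.mem_sdiff.1 hq).2
      have h1 := ih (insert q A) (fun ω => Q ω ∧ ω q = g) (by
        intro ω ω' h
        simp only
        rw [hQ ω ω' fun a ha => h a (Finset.mem_insert_of_mem ha),
          h q (Finset.mem_insert_self _ _)]) (by
        rw [Finset.card_insert_of_notMem hqA]; omega)
      have h2 := card_filter_eq_mul_le A Q hQ q hqA g
      have h3 : c ≤ Fintype.card α - A.card := by omega
      calc _ = _ * c ^ D.card * c := by rw [pow_succ, mul_assoc]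
        _ ≤ (Finset.univ.filter fun ω : α ≃ β => Q ω ∧ ω q = g).card * R.card ^ D.card * c :=
            Nat.mul_le_mul_right _ (by convert h1)
        _ = (Finset.univ.filter fun ω : α ≃ β => Q ω ∧ ω q = g).card * c * R.card ^ D.card := by
            ring
        _ ≤ _ := Nat.mul_le_mul_right _ ((Nat.mul_le_mul_left _ h3).trans h2)
    calc _ ≤ (∑ q ∈ R \ A, (Finset.univ.filter fun ω : α ≃ β =>
          (Q ω ∧ ω q = g) ∧ ∀ g' ∈ D, ω.symm g' ∈ R ∧ ω.symm g' ∉ insert q A).card)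
          * c ^ (D.card + 1) :=
          Nat.mul_le_mul_right _ ((Finset.card_le_card hsub).trans Finset.card_biUnion_le)
      _ ≤ ∑ q ∈ R \ A, (Finset.univ.filter Q).card * R.card ^ D.card := by
          rw [Finset.sum_mul]; exact Finset.sum_le_sum hterm
      _ ≤ R.card * ((Finset.univ.filter Q).card * R.card ^ D.card) := by
          rw [Finset.sum_const, smul_eq_mul]
          exact Nat.mul_le_mul_right _ (Finset.card_le_card Finset.sdiff_subset)
      _ = _ := by ring

lemma card_filter_map_eq_le (k n : ℕ) (e : Sym2 (Fin k)) (he : ¬ e.IsDiag) (e' : Sym2 (Fin n)) :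
    (Finset.univ.filter fun f : Fin k → Fin n => e.map f = e').card ≤ 2 * n ^ (k - 2) := by
  induction e using Sym2.ind with
  | _ u v =>
  induction e' using Sym2.ind with
  | _ x y =>
  have huv : u ≠ v := by simpa using he
  let W := {w : Fin k // w ∉ ({u, v} : Finset (Fin k))}
  have hW : Fintype.card W = k - 2 := by
    rw [Fintype.card_subtype_compl, Fintype.card_fin, Fintype.card_coe, Finset.card_pair huv]
  have hcard : (Finset.univ : Finset (Bool × (W → Fin n))).card = 2 * n ^ (k - 2) := by
    rw [Finset.card_univ, Fintype.card_prod, Fintype.card_bool, Fintype.card_fun, hW,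
      Fintype.card_fin]
  rw [← hcard]
  refine Finset.card_le_card_of_injOn
    (fun f => (decide (f u = x), fun w : W => f w.1)) 
    (fun _ _ => Finset.mem_coe.2 (Finset.mem_univ _)) ?_
  intro f hf f' hf' h
  simp only [Finset.coe_filter, Finset.mem_univ, true_and, Set.mem_ofPred_eq, Sym2.map_mk,
    Sym2.eq_iff] at hf hf'
  simp only [Prod.mk.injEq, decide_eq_decide] at h
  obtain ⟨h1, h2⟩ := h
  have hu : f u = f' u ∧ f v = f' v := by
    rcases hf with ⟨a, b⟩ | ⟨a, b⟩ <;> rcases hf' with ⟨c, d⟩ | ⟨c, d⟩ <;> grind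
  funext w
  by_cases hw : w ∈ ({u, v} : Finset (Fin k))
  · rcases Finset.mem_insert.1 hw with rfl | hw
    · exact hu.1
    · rw [Finset.mem_singleton.1 hw]; exact hu.2
  · exact congrFun h2 ⟨w, hw⟩

/-- The image of an edge under an injective map, as an edge of the complete graph. -/
def mapEdge {k n : ℕ} (f : Fin k → Fin n) (hf : Function.Injective f) (e : CEdge k) : CEdge n :=
  ⟨e.1.map f, by rw [Sym2.isDiag_map hf]; exact e.2⟩

lemma mapEdge_injective {k n : ℕ} (f : Fin k → Fin n) (hf : Function.Injective f) :
    Function.Injective (mapEdge f hf) := fun _ _ h =>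
  Subtype.ext (Sym2.map.injective hf (congrArg Subtype.val h))

/-- The edges of `T`, as edges of the complete graph. -/
noncomputable def treeEdges {k : ℕ} (T : SimpleGraph (Fin k)) : Finset (CEdge k) :=
  Finset.univ.filter fun e => e.1 ∈ T.edgeSet

lemma card_treeEdges {k : ℕ} (T : SimpleGraph (Fin k)) (hT : T.IsTree) :
    (treeEdges T).card + 1 = k := by
  have h := hT.card_edgeFinset
  rw [Fintype.card_fin] at h
  refine Eq.trans ?_ h
  rw [← Finset.card_map (Function.Embedding.subtype _)]
  congr 2
  ext e
  simp only [treeEdges, Finset.mem_map, Finset.mem_filter, Finset.mem_univ, true_and,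
    Function.Embedding.subtype_apply, SimpleGraph.mem_edgeFinset]
  exact ⟨fun ⟨a, ha, hae⟩ => hae ▸ ha, fun he => ⟨⟨e, T.not_isDiag_of_mem_edgeSet he⟩, he, rfl⟩⟩

/-- The event that the edge at position `s` is purchased and is the first edge, as the image of
`e₀`, of a copy of `T` all of whose edges arrive before time `t`. -/
def FirstEdge {k : ℕ} (T : SimpleGraph (Fin k)) (n b t : ℕ) (S : Strategy n) (e₀ : CEdge k)
    (s : Fin (Fintype.card (CEdge n))) (f : Fin k → Fin n) (ω : EdgeOrdering n) : Prop :=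
  ∃ hf : Function.Injective f, (Purchased n b S s ω ∧ ω s = mapEdge f hf e₀) ∧
    ∀ g ∈ ((treeEdges T).erase e₀).image (mapEdge f hf),
      ω.symm g ∈ (Finset.univ.filter fun i : Fin (Fintype.card (CEdge n)) => (i : ℕ) < t) ∧
        ω.symm g ∉ Finset.Iic s

lemma exists_firstEdge {k : ℕ} (hk : 3 ≤ k) (T : SimpleGraph (Fin k)) (hT : T.IsTree)
    (n b t : ℕ) (S : Strategy n) (ω : EdgeOrdering n)
    (h : containsCopy T n (build n b S ω t)) :
    ∃ e₀ ∈ treeEdges T, ∃ s ∈ Finset.univ.filter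
      (fun i : Fin (Fintype.card (CEdge n)) => (i : ℕ) < t),
      ∃ f, FirstEdge T n b t S e₀ s f ω := by
  obtain ⟨f, hf, hcopy⟩ := h
  have hmem : ∀ e ∈ treeEdges T, mapEdge f hf e ∈ build n b S ω t := by
    rintro ⟨e, hd⟩ he
    induction e using Sym2.ind with
    | _ u v =>
    have he' : T.Adj u v := by simpa [treeEdges] using he
    obtain ⟨e', h1, h2⟩ := hcopy u v he'
    have : mapEdge f hf ⟨s(u, v), hd⟩ = e' := Subtype.ext (by simp [mapEdge, h2])
    rwa [this]
  have hne : (treeEdges T).Nonempty := by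
    have := card_treeEdges T hT
    exact Finset.card_pos.1 (by omega)
  obtain ⟨e₀, he₀, hmin⟩ :=
    Finset.exists_min_image (treeEdges T) (fun e => ω.symm (mapEdge f hf e)) hne
  have hb := (mem_build n b S ω t _).1 (hmem e₀ he₀)
  refine ⟨e₀, he₀, ω.symm (mapEdge f hf e₀), by simpa using hb.1, f, hf, ⟨hb.2, by simp⟩, ?_⟩
  intro g hg
  obtain ⟨e, he, rfl⟩ := Finset.mem_image.1 hg
  obtain ⟨hne, he⟩ := Finset.mem_erase.1 he
  refine ⟨by simpa using ((mem_build n b S ω t _).1 (hmem e he)).1, fun hle => hne ?_⟩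
  have := le_antisymm (Finset.mem_Iic.1 hle) (hmin e he)
  exact mapEdge_injective f hf (ω.symm.injective this)

lemma card_filter_val_lt_le (m t : ℕ) :
    (Finset.univ.filter fun i : Fin m => (i : ℕ) < t).card ≤ t := by
  have h : (Finset.univ.filter fun i : Fin m => (i : ℕ) < t).card ≤ (Finset.range t).card :=
    Finset.card_le_card_of_injOn (fun i => (i : ℕ)) (fun i hi => by simpa using hi)
      Fin.val_injective.injOn
  simpa using h

lemma card_firstEdge_mul_le {k : ℕ} (T : SimpleGraph (Fin k)) (hT : T.IsTree)
    (n b t c : ℕ) (S : Strategy n) (hc : c + t + k ≤ Fintype.card (CEdge n))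
    (e₀ : CEdge k) (he₀ : e₀ ∈ treeEdges T) (s : Fin (Fintype.card (CEdge n)))
    (hs : (s : ℕ) < t) (f : Fin k → Fin n) :
    (Finset.univ.filter (FirstEdge T n b t S e₀ s f)).card * c ^ (k - 2) ≤
      (Finset.univ.filter fun ω : EdgeOrdering n =>
        Purchased n b S s ω ∧ e₀.1.map f = (ω s).1).card * t ^ (k - 2) := by
  by_cases hf : Function.Injective f
  · have hD : (((treeEdges T).erase e₀).image (mapEdge f hf)).card = k - 2 := by
      rw [Finset.card_image_of_injective _ (mapEdge_injective f hf), Finset.card_erase_of_mem he₀]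
      have := card_treeEdges T hT
      omega
    have h := card_filter_forall_mul_pow_le
      (Finset.univ.filter fun i : Fin (Fintype.card (CEdge n)) => (i : ℕ) < t) c
      (((treeEdges T).erase e₀).image (mapEdge f hf)) (Finset.Iic s)
      (fun ω : EdgeOrdering n => Purchased n b S s ω ∧ ω s = mapEdge f hf e₀) (by
        intro ω ω' h
        simp only
        rw [purchased_congr n b S s ω ω' fun i hi => h i (Finset.mem_Iic.2 hi),
          h s (Finset.mem_Iic.2 le_rfl)]) (by
        rw [hD, Fin.card_Iic, Fintype.card_fin]; omega)
    rw [hD] at h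
    refine le_trans (le_of_eq ?_) (h.trans ?_)
    · congr 2
      ext ω
      simp only [Finset.mem_filter, Finset.mem_univ, true_and, FirstEdge]
      exact ⟨fun ⟨_, h⟩ => h, fun h => ⟨hf, h⟩⟩
    · refine Nat.mul_le_mul (Finset.card_le_card fun ω hω => ?_)
        (Nat.pow_le_pow_left (card_filter_val_lt_le _ _) _)
      simp only [Finset.mem_filter, Finset.mem_univ, true_and] at hω ⊢
      exact ⟨hω.1, by rw [hω.2]; rfl⟩
  · have : Finset.univ.filter (FirstEdge T n b t S e₀ s f) = ∅ := by
      ext ω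
      simp [FirstEdge, hf]
    simp [this]

lemma card_containsCopy_mul_le {k : ℕ} (hk : 3 ≤ k) (T : SimpleGraph (Fin k)) (hT : T.IsTree)
    (n b t c : ℕ) (S : Strategy n) (hc : c + t + k ≤ Fintype.card (CEdge n)) :
    (Finset.univ.filter fun ω : EdgeOrdering n =>
      containsCopy T n (build n b S ω t)).card * c ^ (k - 2) ≤
      2 * k * b * (n ^ (k - 2) * t ^ (k - 2)) * Fintype.card (EdgeOrdering n) := by
  set R := Finset.univ.filter fun i : Fin (Fintype.card (CEdge n)) => (i : ℕ) < t with hR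
  have hsub : (Finset.univ.filter fun ω : EdgeOrdering n =>
      containsCopy T n (build n b S ω t)) ⊆
      (treeEdges T).biUnion fun e₀ => R.biUnion fun s => Finset.univ.biUnion fun f =>
        Finset.univ.filter (FirstEdge T n b t S e₀ s f) := by
    intro ω hω
    obtain ⟨e₀, he₀, s, hs, f, h⟩ :=
      exists_firstEdge hk T hT n b t S ω (Finset.mem_filter.1 hω).2
    simp only [Finset.mem_biUnion, Finset.mem_filter, Finset.mem_univ, true_and]
    exact ⟨e₀, he₀, s, hs, f, h⟩
  have hfix : ∀ e₀ ∈ treeEdges T, ∀ s ∈ R,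
      (∑ f, (Finset.univ.filter (FirstEdge T n b t S e₀ s f)).card) * c ^ (k - 2) ≤
        (Finset.univ.filter (Purchased n b S s)).card * (2 * n ^ (k - 2)) * t ^ (k - 2) := by
    intro e₀ he₀ s hs
    rw [Finset.sum_mul]
    refine (Finset.sum_le_sum fun f _ => card_firstEdge_mul_le T hT n b t c S hc e₀ he₀ s
      (Finset.mem_filter.1 hs).2 f).trans ?_
    rw [← Finset.sum_mul]
    refine Nat.mul_le_mul_right _ ?_
    simp_rw [← Finset.filter_filter]
    refine (le_of_eq (Finset.sum_card_bipartiteAbove_eq_sum_card_bipartiteBelow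
      (fun (f : Fin k → Fin n) (ω : EdgeOrdering n) => e₀.1.map f = (ω s).1))).trans ?_
    refine (Finset.sum_le_card_nsmul _ _ _ fun ω _ => ?_).trans (le_of_eq (smul_eq_mul _ _))
    exact card_filter_map_eq_le k n e₀.1 e₀.2 _
  have hpur : ∑ s ∈ R, (Finset.univ.filter (Purchased n b S s)).card ≤
      b * Fintype.card (EdgeOrdering n) := by
    calc _ ≤ ∑ s, (Finset.univ.filter (Purchased n b S s)).card :=
          Finset.sum_le_univ_sum_of_nonneg fun _ => Nat.zero_le _
      _ = ∑ ω, (Finset.univ.filter fun s => Purchased n b S s ω).card :=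
          Finset.sum_card_bipartiteAbove_eq_sum_card_bipartiteBelow (Purchased n b S)
      _ ≤ _ := by
          refine (Finset.sum_le_card_nsmul _ _ b fun ω _ => card_purchased_le n b S ω).trans ?_
          rw [smul_eq_mul, mul_comm, Finset.card_univ]
  calc _ ≤ (∑ e₀ ∈ treeEdges T, ∑ s ∈ R, ∑ f,
        (Finset.univ.filter (FirstEdge T n b t S e₀ s f)).card) * c ^ (k - 2) := by
        refine Nat.mul_le_mul_right _ ((Finset.card_le_card hsub).trans ?_)
        refine Finset.card_biUnion_le.trans (Finset.sum_le_sum fun e₀ _ => ?_)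
        refine Finset.card_biUnion_le.trans (Finset.sum_le_sum fun s _ => ?_)
        exact Finset.card_biUnion_le
    _ = ∑ e₀ ∈ treeEdges T, ∑ s ∈ R, (∑ f,
        (Finset.univ.filter (FirstEdge T n b t S e₀ s f)).card) * c ^ (k - 2) := by
        simp_rw [Finset.sum_mul]
    _ ≤ ∑ e₀ ∈ treeEdges T, ∑ s ∈ R,
        (Finset.univ.filter (Purchased n b S s)).card * (2 * n ^ (k - 2)) * t ^ (k - 2) :=
        Finset.sum_le_sum fun e₀ he₀ => Finset.sum_le_sum fun s hs => hfix e₀ he₀ s hs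
    _ = (treeEdges T).card * ((∑ s ∈ R, (Finset.univ.filter (Purchased n b S s)).card) *
        (2 * n ^ (k - 2)) * t ^ (k - 2)) := by
        rw [Finset.sum_const, smul_eq_mul, Finset.sum_mul, Finset.sum_mul]
    _ ≤ k * ((b * Fintype.card (EdgeOrdering n)) * (2 * n ^ (k - 2)) * t ^ (k - 2)) := by
        have := card_treeEdges T hT
        gcongr
        omega
    _ = _ := by ring

lemma card_cEdge (n : ℕ) : Fintype.card (CEdge n) = n.choose 2 := by
  have := Sym2.card_subtype_not_diag (α := Fin n)
  rw [Fintype.card_fin] at this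
  rw [← this]

lemma uprob_nonneg {α : Type} [Fintype α] (P : α → Prop) : 0 ≤ uprob P := by
  unfold uprob; positivity

lemma uprob_containsCopy_le {k : ℕ} (hk : 3 ≤ k) (T : SimpleGraph (Fin k)) (hT : T.IsTree)
    (n b t : ℕ) (S : Strategy n) (hn : k + 4 ≤ n) (ht : t ≤ n) :
    uprob (fun ω : EdgeOrdering n => containsCopy T n (build n b S ω t)) ≤
      2 * k * 8 ^ (k - 2) * (b * ((t : ℝ) / n) ^ (k - 2)) := by
  have hchoose : n.choose 2 * 2 = n * (n - 1) := by
    rw [Nat.choose_two_right, Nat.div_mul_cancel (Nat.even_mul_pred_self n).two_dvd]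
  have hsq : n * (n - 1) + n = n * n := by
    obtain ⟨m, rfl⟩ : ∃ m, n = m + 1 := ⟨n - 1, by omega⟩
    simp; ring
  have hlarge : n ^ 2 + 8 * (t + k) ≤ 8 * n.choose 2 := by nlinarith
  obtain ⟨c, hc⟩ : ∃ c, c + t + k = n.choose 2 := 
    ⟨n.choose 2 - t - k, by have := Nat.zero_le (n ^ 2); omega⟩
  have hc8 : (n : ℝ) ^ 2 ≤ 8 * c := by
    have : n ^ 2 ≤ 8 * c := by omega
    exact_mod_cast this
  have hn0 : (0 : ℝ) < n := by exact_mod_cast (show 0 < n by omega)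
  have hc0 : (0 : ℝ) < c := by nlinarith
  have hmain : ((Finset.univ.filter fun ω : EdgeOrdering n =>
      containsCopy T n (build n b S ω t)).card : ℝ) * (c : ℝ) ^ (k - 2) ≤
      2 * k * b * ((n : ℝ) ^ (k - 2) * (t : ℝ) ^ (k - 2)) * Fintype.card (EdgeOrdering n) := by
    exact_mod_cast card_containsCopy_mul_le hk T hT n b t c S (by rw [card_cEdge, hc])
  have hratio : ((n : ℝ) * t / c) ^ (k - 2) ≤ (8 * ((t : ℝ) / n)) ^ (k - 2) := by
    refine pow_le_pow_left₀ (by positivity) ?_ _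
    rw [mul_div_assoc', div_le_div_iff₀ hc0 hn0]
    have : (0 : ℝ) ≤ t := by positivity
    nlinarith
  unfold uprob
  refine div_le_of_le_mul₀ (by positivity) (by positivity) ?_
  calc _ ≤ 2 * k * b * ((n : ℝ) ^ (k - 2) * (t : ℝ) ^ (k - 2)) *
        Fintype.card (EdgeOrdering n) / (c : ℝ) ^ (k - 2) :=
        (le_div_iff₀ (by positivity)).2 hmain
    _ = 2 * k * b * ((n : ℝ) * t / c) ^ (k - 2) * Fintype.card (EdgeOrdering n) := by
        rw [div_pow, mul_pow]; ring
    _ ≤ 2 * k * b * (8 * ((t : ℝ) / n)) ^ (k - 2) * Fintype.card (EdgeOrdering n) := by gcongr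
    _ = _ := by rw [mul_pow]; ring

lemma uprob_containsCopy_zero_budget {k : ℕ} (hk : 3 ≤ k) (T : SimpleGraph (Fin k))
    (hT : T.IsTree) (n t : ℕ) (S : Strategy n) :
    uprob (fun ω : EdgeOrdering n => containsCopy T n (build n 0 S ω t)) = 0 := by
  have : Finset.univ.filter (fun ω : EdgeOrdering n =>
      containsCopy T n (build n 0 S ω t)) = ∅ := by
    refine Finset.filter_eq_empty_iff.2 fun ω _ h => ?_
    obtain ⟨_, _, _, _, _, _, ⟨hp, _⟩, _⟩ := exists_firstEdge hk T hT n 0 t S ω h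
    exact absurd hp.2 (Nat.not_lt_zero _)
  unfold uprob
  rw [this]
  simp

/-- Small trees, 0-statement: if `b ≪ (n/t)^{k-2}` (i.e. `b (t/n)^{k-2} → 0`), then every
`(t,b)`-strategy fails, with high probability, to build a copy of the `k`-vertex tree `T`. -/
theorem stmt6 (k : ℕ) (hk : 3 ≤ k) (T : SimpleGraph (Fin k)) (hT : T.IsTree) (t b : ℕ → ℕ)
    (hb : Tendsto
      (fun n : ℕ => (b n : ℝ) * ((t n : ℝ) / (n : ℝ)) ^ (k - 2)) atTop (nhds 0)) :
    ∀ S : (n : ℕ) → Strategy n,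
      Tendsto
        (fun n => uprob (fun ω : EdgeOrdering n =>
          containsCopy T n (build n (b n) (S n) ω (t n))))
        atTop (nhds 0) := by
  intro S
  have hlim : Tendsto (fun n : ℕ =>
      2 * (k : ℝ) * 8 ^ (k - 2) * ((b n : ℝ) * ((t n : ℝ) / (n : ℝ)) ^ (k - 2))) atTop (nhds 0) := by
    simpa using hb.const_mul (2 * (k : ℝ) * 8 ^ (k - 2))
  refine tendsto_of_tendsto_of_tendsto_of_le_of_le' tendsto_const_nhds hlim
    (Eventually.of_forall fun n => uprob_nonneg _) ?_
  filter_upwards [eventually_ge_atTop (k + 4), hb.eventually_lt_const one_pos] with n hn hlt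
  by_cases ht : t n ≤ n
  · exact uprob_containsCopy_le hk T hT n (b n) (t n) (S n) hn ht
  · have hn0 : (0 : ℝ) < n := by exact_mod_cast (show 0 < n by omega)
    have h1 : (1 : ℝ) ≤ (t n : ℝ) / n := by
      rw [one_le_div hn0]
      exact_mod_cast (not_le.1 ht).le
    have h2 : (b n : ℝ) < 1 :=
      lt_of_le_of_lt (le_mul_of_one_le_right (by positivity) (one_le_pow₀ h1)) hlt
    have h3 : b n = 0 := by
      have : b n < 1 := by exact_mod_cast h2
      omega
    rw [h3, uprob_containsCopy_zero_budget hk T hT n (t n) (S n)]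
    simp
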